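/- Let Φ:[0,∞)→ℝ be a C¹ function with Φ' nonincreasing, satisfying the differential inequality -2Φ'(t) ≤ C·limsup_{δ↓0}(Φ'(t+δ)-Φ'(t))/δ for all t>0 with constant C>0, and suppose Φ(t) → L and Φ'(t) → 0 as t→∞. Then Φ(0) - L ≤ -(C/2)·Φ'(0). -/

import Mathlib

open Filter Set Topology

/-- A monotone function on `ℝ` whose right derivative vanishes everywhere is constant on some
nontrivial subinterval of every open interval. It may be discontinuous from the left. -/
lemma Monotone.exists_eq_of_hasDerivWithinAt_Ici_zero {σ : ℝ → ℝ} (hσ : Monotone σ)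
    (hd : ∀ y, HasDerivWithinAt σ 0 (Ici y) y) {p q : ℝ} (hpq : p < q) :
    ∃ c ∈ Ioo p q, ∃ d ∈ Ioo p q, c < d ∧ σ c = σ d := by
  have hright : ∀ y, ∃ r > 0, ∀ z, y ≤ z → z < y + r → σ z - σ y ≤ z - y := by
    intro y
    have h := (hasDerivWithinAt_iff_isLittleO.1 (hd y)).bound one_pos
    obtain ⟨r, hr, hsub⟩ := Metric.mem_nhdsWithin_iff.1 h
    refine ⟨r, hr, fun z hz hzr => ?_⟩
    have hz' := hsub ⟨by rw [Metric.mem_ball, Real.dist_eq, abs_of_nonneg] <;> linarith, hz⟩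
    simp only [mem_ofPred_eq, smul_zero, sub_zero, one_mul, Real.norm_eq_abs] at hz'
    rw [abs_of_nonneg (sub_nonneg.2 hz)] at hz'
    exact (le_abs_self _).trans hz'
  let A : ℕ → Set ℝ := fun n =>
    {y | ∀ z, y < z → z < y + 1 / ((n : ℝ) + 1) → σ z - σ y ≤ z - y}
  have hclosed : ∀ n, IsClosed (A n) := by
    intro n
    rw [← closure_subset_iff_isClosed]
    intro y hy z hyz hzn
    obtain ⟨r, hr, hry⟩ := hright y
    refine le_of_forall_pos_le_add fun ε hε => ?_
    obtain ⟨w, hwA, hw⟩ := Metric.mem_closure_iff.1 hy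
      (min (min r (ε / 2)) (min (z - y) (y + 1 / ((n : ℝ) + 1) - z)))
      (by
        refine lt_min (lt_min hr (by linarith)) (lt_min (by linarith) (by linarith)))
    rw [Real.dist_eq, lt_min_iff, lt_min_iff, lt_min_iff] at hw
    obtain ⟨⟨h1, h2⟩, h3, h4⟩ := hw
    rw [abs_lt] at h1 h2 h3 h4
    have hzw := hwA z (by linarith) (by linarith)
    rcases le_total w y with hwy | hwy
    · have := hσ hwy
      linarith
    · have := hry w hwy (by linarith)
      linarith
  have hunion : ⋃ n, A n = univ := by
    refine eq_univ_of_forall fun y => mem_iUnion.2 ?_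
    obtain ⟨r, hr, hry⟩ := hright y
    obtain ⟨n, hn⟩ := exists_nat_one_div_lt hr
    exact ⟨n, fun z hyz hz => hry z hyz.le (by linarith)⟩
  obtain ⟨x, hxI, hx⟩ := (dense_iUnion_interior_of_closed hclosed hunion).inter_open_nonempty
    (Ioo p q) isOpen_Ioo (nonempty_Ioo.2 hpq)
  obtain ⟨n, hxn⟩ := mem_iUnion.1 hx
  have hnhds : interior (A n) ∩ Ioo p q ∈ 𝓝 x :=
    (isOpen_interior.inter isOpen_Ioo).mem_nhds ⟨hxn, hxI⟩
  obtain ⟨r, hr, hball⟩ := Metric.mem_nhds_iff.1 hnhds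
  have hn : (0 : ℝ) < 1 / ((n : ℝ) + 1) := by positivity
  obtain ⟨e, he, her⟩ := exists_between (lt_min hr hn)
  have hmem : ∀ y ∈ Icc x (x + e), y ∈ A n ∧ y ∈ Ioo p q := by
    intro y hy
    have := hball (show y ∈ Metric.ball x r by
      rw [Metric.mem_ball, Real.dist_eq, abs_of_nonneg (by linarith [hy.1])]
      linarith [hy.2, her.trans_le (min_le_left r (1 / ((n : ℝ) + 1)))])
    exact ⟨interior_subset this.1, this.2⟩
  have hcont : ContinuousOn σ (Icc x (x + e)) := by
    refine LipschitzOnWith.continuousOn (K := 1) (LipschitzOnWith.of_le_add_mul 1 ?_)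
    intro y hy z hz
    rcases le_or_gt y z with hyz | hyz
    · have := hσ hyz
      have : 0 ≤ dist y z := dist_nonneg
      simp only [NNReal.coe_one, one_mul]
      linarith
    · have := (hmem z hz).1 y hyz
        (by linarith [hy.2, hz.1, her.trans_le (min_le_right r (1 / ((n : ℝ) + 1)))])
      simp only [NNReal.coe_one, one_mul, Real.dist_eq]
      linarith [le_abs_self (y - z)]
  have hright_mem : x + e ∈ Icc x (x + e) := ⟨by linarith, le_rfl⟩
  exact ⟨x, hxI, x + e, (hmem _ hright_mem).2, by linarith,
    (constant_of_has_deriv_right_zero hcont (fun y _ => hd y) _ hright_mem).symm⟩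

/-- A continuous function that, at every point, either takes smaller values arbitrarily close to
the right or has right derivative `+∞`, does not increase. -/
lemma ContinuousOn.le_of_frequently_lt_or_tendsto_slope_atTop {u : ℝ → ℝ} {a b : ℝ} (hab : a ≤ b)
    (hu : ContinuousOn u (Icc a b))
    (h : ∀ t ∈ Ico a b, (∃ᶠ s in 𝓝[>] t, u s < u t) ∨ Tendsto (slope u t) (𝓝[>] t) atTop) :
    u b ≤ u a := by
  by_contra! hlt
  have hlast : ∀ y, ∃ t, IsGreatest {t ∈ Icc a b | u t ≤ max (u a) y} t := by
    intro y
    have hcompact : IsCompact {t ∈ Icc a b | u t ≤ max (u a) y} :=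
      isCompact_Icc.of_isClosed_subset
        (hu.preimage_isClosed_of_isClosed isClosed_Icc isClosed_Iic) (fun t ht => ht.1)
    exact hcompact.exists_isGreatest ⟨a, left_mem_Icc.2 hab, le_max_left _ _⟩
  choose σ hσ using hlast
  have hmono : Monotone σ := fun y z hyz =>
    (hσ z).2 ⟨(hσ y).1.1, (hσ y).1.2.trans (max_le_max_left _ hyz)⟩
  have hgt : ∀ y, ∀ s ∈ Icc a b, σ y < s → max (u a) y < u s := by
    intro y s hs hlts
    by_contra! hle
    exact hlts.not_ge ((hσ y).2 ⟨hs, hle⟩)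
  have hval : ∀ y, y < u b → u (σ y) = max (u a) y := by
    intro y hy
    refine le_antisymm (hσ y).1.2 ?_
    obtain ⟨t, ht, htu⟩ := intermediate_value_Icc (hσ y).1.1.2
      (hu.mono (Icc_subset_Icc_left (hσ y).1.1.1)) ⟨(hσ y).1.2, (max_lt hlt hy).le⟩
    have hts : t ≤ σ y :=
      (hσ y).2 ⟨⟨(hσ y).1.1.1.trans ht.1, ht.2⟩, htu.le⟩
    rw [← htu, le_antisymm hts ht.1]
  have hderiv : ∀ y, HasDerivWithinAt σ 0 (Ici y) y := by
    intro y
    rcases le_or_gt (u b) y with hby | hyb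
    · have hb : ∀ z ∈ Ici y, σ z = b := fun z hz =>
        le_antisymm (hσ z).1.1.2
          ((hσ z).2 ⟨right_mem_Icc.2 hab, (hby.trans hz).trans (le_max_right _ _)⟩)
      exact (hasDerivWithinAt_const y (Ici y) b).congr hb (hb y self_mem_Ici)
    have htb : σ y < b := by
      refine lt_of_le_of_ne (hσ y).1.1.2 fun hb => ?_
      have := (hσ y).1.2
      rw [hb] at this
      exact this.not_gt (max_lt hlt hyb)
    have hslope : Tendsto (slope u (σ y)) (𝓝[>] (σ y)) atTop := by
      refine (h (σ y) ⟨(hσ y).1.1.1, htb⟩).resolve_left fun hf => hf ?_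
      filter_upwards [Ioc_mem_nhdsGT htb] with s hs
      have := hgt y s ⟨(hσ y).1.1.1.trans hs.1.le, hs.2⟩ hs.1
      rw [hval y hyb]
      exact this.not_gt
    rw [hasDerivWithinAt_iff_isLittleO, Asymptotics.isLittleO_iff]
    intro η hη
    obtain ⟨w, hw, hwsub⟩ := (mem_nhdsGT_iff_exists_Ioo_subset' htb).1
      (hslope.eventually_ge_atTop (1 / η))
    set w' := min w b
    have hw' : σ y < w' := lt_min hw htb
    obtain ⟨m, hm, hmle⟩ : ∃ m, max (u a) y < m ∧ ∀ s ∈ Icc w' b, m ≤ u s := by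
      obtain ⟨s, hs, hsmin⟩ := isCompact_Icc.exists_isMinOn
        (nonempty_Icc.2 (min_le_right w b))
        (hu.mono (Icc_subset_Icc_left ((hσ y).1.1.1.trans hw'.le)))
      exact ⟨u s, hgt y s ⟨(hσ y).1.1.1.trans (hw'.le.trans hs.1), hs.2⟩ (hw'.trans_le hs.1),
        fun s' hs' => hsmin hs'⟩
    have hym : y < min m (u b) := lt_min ((le_max_right _ _).trans_lt hm) hyb
    have hnear : Iio (min m (u b)) ∈ 𝓝[≥] y := mem_nhdsWithin_of_mem_nhds (Iio_mem_nhds hym)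
    filter_upwards [hnear, self_mem_nhdsWithin] with z hz hyz
    have hzm : z < m := hz.trans_le (min_le_left _ _)
    have hzb : z < u b := hz.trans_le (min_le_right _ _)
    have hyz' : y ≤ z := hyz
    have hle := hmono hyz'
    rw [smul_zero, sub_zero, Real.norm_eq_abs, Real.norm_eq_abs, abs_of_nonneg (sub_nonneg.2 hle),
      abs_of_nonneg (sub_nonneg.2 hyz')]
    rcases hle.eq_or_lt with heq | hlt'
    · rw [heq, sub_self]
      exact mul_nonneg hη.le (sub_nonneg.2 hyz')
    have hσw : σ z < w' := by
      by_contra! hge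
      have h1 := hmle (σ z) ⟨hge, (hσ z).1.1.2⟩
      exact (h1.trans (hσ z).1.2).not_gt (max_lt ((le_max_left _ _).trans_lt hm) hzm)
    have hs : 1 / η ≤ slope u (σ y) (σ z) := hwsub ⟨hlt', hσw.trans_le (min_le_left _ _)⟩
    rw [slope_def_field, hval y hyb, hval z hzb, div_le_div_iff₀ hη (sub_pos.2 hlt'), one_mul] at hs
    have hmax : max (u a) z - max (u a) y ≤ z - y := by
      rcases max_cases (u a) z with ⟨h1, h2⟩ | ⟨h1, h2⟩ <;>
      linarith [le_max_left (u a) y, le_max_right (u a) y]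
    calc σ z - σ y ≤ (max (u a) z - max (u a) y) * η := hs
      _ ≤ (z - y) * η := mul_le_mul_of_nonneg_right hmax hη.le
      _ = η * (z - y) := mul_comm _ _
  obtain ⟨c, hc, d, hd, hcd, heq⟩ := hmono.exists_eq_of_hasDerivWithinAt_Ici_zero hderiv hlt
  have hc' := hval c hc.2
  rw [heq, hval d hd.2, max_eq_right hc.1.le, max_eq_right hd.1.le] at hc'
  exact hcd.ne' hc'

/-- ODE argument underlying the Poincaré–Lichnerowicz inequality via heat flow:
if `Φ` is `C¹` on `[0,∞)` with `Φ'` nonincreasing, satisfies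
`-2 Φ'(t) ≤ C · limsup_{δ↓0} (Φ'(t+δ) - Φ'(t))/δ` for `t > 0`,
and `Φ(t) → L`, `Φ'(t) → 0` as `t → ∞`, then `Φ(0) - L ≤ -(C/2) Φ'(0)`. -/
theorem stmt_0 (Φ : ℝ → ℝ) (C L : ℝ) (hC : 0 < C)
    (hΦ : ContDiffOn ℝ 1 Φ (Ici 0))
    (hmono : AntitoneOn (derivWithin Φ (Ici 0)) (Ici 0))
    (hineq : ∀ t > 0, -2 * derivWithin Φ (Ici 0) t ≤
      C * limsup (fun δ : ℝ =>
        (derivWithin Φ (Ici 0) (t + δ) - derivWithin Φ (Ici 0) t) / δ)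
        (nhdsWithin 0 (Ioi 0)))
    (hlim : Tendsto Φ atTop (nhds L))
    (hlim' : Tendsto (derivWithin Φ (Ici 0)) atTop (nhds 0)) :
    Φ 0 - L ≤ -(C / 2) * derivWithin Φ (Ici 0) 0 := by
  set G := derivWithin Φ (Ici 0) with hG
  have hΦc : ContinuousOn Φ (Ici 0) := hΦ.continuousOn
  have hGc : ContinuousOn G (Ici 0) :=
    hΦ.continuousOn_derivWithin (uniqueDiffOn_Ici 0) le_rfl
  have hΦd : ∀ t > 0, HasDerivAt Φ (G t) t := fun t ht =>
    ((hΦ.differentiableOn one_ne_zero t ht.le).hasDerivWithinAt).hasDerivAt (Ici_mem_nhds ht)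
  have hstep : ∀ a > 0, ∀ b, a ≤ b → ∀ ε > 0,
      Φ a + C / 2 * G a + ε * a ≤ Φ b + C / 2 * G b + ε * b := by
    intro a ha b hab ε hε
    set u : ℝ → ℝ := fun t => -(Φ t + C / 2 * G t + ε * t) with hu
    have hsub : Icc a b ⊆ Ici 0 := fun t ht => ha.le.trans ht.1
    have huc : ContinuousOn u (Icc a b) :=
      (((hΦc.mono hsub).add (continuousOn_const.mul (hGc.mono hsub))).add
        (continuousOn_const.mul continuousOn_id)).neg
    suffices hub : u b ≤ u a from neg_le_neg_iff.1 hub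
    refine huc.le_of_frequently_lt_or_tendsto_slope_atTop hab ?_
    intro t ht
    have ht0 : 0 < t := ha.trans_le ht.1
    have hmap : map (fun δ : ℝ => t + δ) (𝓝[>] 0) = 𝓝[>] t := by
      simp
    rw [← hmap, frequently_map, tendsto_map'_iff]
    set Q : ℝ → ℝ := fun δ => (G (t + δ) - G t) / δ with hQ
    set P : ℝ → ℝ := fun δ => (Φ (t + δ) - Φ t) / δ with hP
    have hPlim : Tendsto P (𝓝[>] 0) (𝓝 (G t)) := by
      have := (hΦd t ht0).tendsto_slope_zero_right
      refine this.congr fun δ => ?_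
      rw [hP, smul_eq_mul, inv_mul_eq_div]
    have hdiff : ∀ δ > 0, u (t + δ) - u t = -(P δ + C / 2 * Q δ + ε) * δ := by
      intro δ hδ
      simp only [hu, hP, hQ]
      field_simp
      ring
    by_cases hbot : Tendsto Q (𝓝[>] 0) atBot
    · right
      have hlim_sum : Tendsto (fun δ => -(P δ + ε + C / 2 * Q δ)) (𝓝[>] 0) atTop :=
        tendsto_neg_atBot_atTop.comp
          ((hPlim.add_const ε).add_atBot (hbot.const_mul_atBot (half_pos hC)))
      refine hlim_sum.congr' ?_
      filter_upwards [self_mem_nhdsWithin] with δ hδ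
      have hδ' : (0 : ℝ) < δ := hδ
      rw [Function.comp_apply, slope_def_field, hdiff δ hδ, add_sub_cancel_left,
        mul_div_cancel_right₀ _ hδ'.ne']
      ring
    · left
      obtain ⟨M, hM⟩ : ∃ M, ∃ᶠ δ in 𝓝[>] 0, M ≤ Q δ := by
        by_contra! hcon
        refine hbot (tendsto_atBot.2 fun M => ?_)
        exact (hcon M).mono fun δ hδ => hδ.le
      have hcob : IsCoboundedUnder (· ≤ ·) (𝓝[>] 0) Q := IsCoboundedUnder.of_frequently_ge hM
      have hlt : -(2 * G t + ε) / C < limsup Q (𝓝[>] 0) := by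
        rw [div_lt_iff₀ hC]
        linarith [hineq t ht0]
      have hPev : ∀ᶠ δ in 𝓝[>] 0, G t - ε / 2 < P δ :=
        hPlim.eventually_const_lt (by linarith)
      refine ((frequently_lt_of_lt_limsup hcob hlt).and_eventually
        (hPev.and self_mem_nhdsWithin)).mono ?_
      rintro δ ⟨hQδ, hPδ, hδ⟩
      rw [div_lt_iff₀ hC] at hQδ
      have hpos : 0 < P δ + C / 2 * Q δ + ε := by linarith
      have := mul_pos hpos hδ
      linarith [hdiff δ hδ]
  have hle : ∀ a > 0, ∀ b, a ≤ b → Φ a + C / 2 * G a ≤ Φ b + C / 2 * G b := by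
    intro a ha b hab
    refine le_of_forall_pos_le_add fun η hη => ?_
    have h1 : 0 < b - a + 1 := by linarith
    have h2 := hstep a ha b hab (η / (b - a + 1)) (by positivity)
    have h3 : η / (b - a + 1) * (b - a + 1) = η := div_mul_cancel₀ _ h1.ne'
    have h4 : 0 < η / (b - a + 1) := by positivity
    linarith
  have hinfty : Tendsto (fun t => Φ t + C / 2 * G t) atTop (𝓝 L) := by
    simpa using hlim.add (hlim'.const_mul (C / 2))
  have hleL : ∀ a > 0, Φ a + C / 2 * G a ≤ L := fun a ha =>
    ge_of_tendsto hinfty (eventually_atTop.2 ⟨a, hle a ha⟩)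
  have hzero : Tendsto (fun t => Φ t + C / 2 * G t) (𝓝[>] 0) (𝓝 (Φ 0 + C / 2 * G 0)) :=
    ((hΦc.add (continuousOn_const.mul hGc)) 0 self_mem_Ici).mono_left
      (nhdsWithin_mono 0 Ioi_subset_Ici_self)
  have := le_of_tendsto hzero (eventually_nhdsWithin_of_forall hleL)
  linarith
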